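/- (Ergodic theorem.) Let (Ω,M) be a finite transformation monoid, ν a probability distribution on Ω, and μ a probability distribution on M such that the submonoid N generated by the support of μ is transitive on Ω. Define the stochastic matrix P(α,β) = Σ_{m : αm = β} μ(m), and let π be a stationary distribution for P, i.e., a probability distribution on Ω with Σ_α π(α)P(α,β) = π(β) for all β. If f : Ω → ℝ is a function such that E_ν(mf) = E_ν(f) for all m ∈ N, where (mf)(ω) = f(ωm) and E_θ(g) = Σ_ω g(ω)θ(ω), then E_π(f) = E_ν(f). -/

import Mathlib

/-- The Markov operator `g ↦ (α ↦ ∑ m, μ m * g (m α))` of a random self-map. -/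
def markovOp {Ω : Type*} [Fintype Ω] [DecidableEq Ω] (μ : (Ω → Ω) → ℝ) :
    (Ω → ℝ) →ₗ[ℝ] (Ω → ℝ) where
  toFun g α := ∑ m : Ω → Ω, μ m * g (m α)
  map_add' g h := by ext α; simp [mul_add, Finset.sum_add_distrib]
  map_smul' c g := by
    ext α
    simp only [Pi.smul_apply, smul_eq_mul, RingHom.id_apply, Finset.mul_sum]
    exact Finset.sum_congr rfl fun m _ => by ring

/-- The functions whose expectation with respect to `ν` is invariant under all maps in `N`. -/
def invariantFunctions {Ω : Type*} [Fintype Ω] (ν : Ω → ℝ) (N : Submonoid (Function.End Ω)) :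
    Submodule ℝ (Ω → ℝ) where
  carrier := {g | ∀ m ∈ N, ∑ ω : Ω, g (m ω) * ν ω = ∑ ω : Ω, g ω * ν ω}
  zero_mem' := by intro m _; simp
  add_mem' := by
    intro g h hg hh m hm
    simp only [Pi.add_apply, add_mul, Finset.sum_add_distrib, hg m hm, hh m hm]
  smul_mem' := by
    intro c g hg m hm
    simp only [Pi.smul_apply, smul_eq_mul, mul_assoc, ← Finset.mul_sum, hg m hm]

theorem sum_markovOp_comp_mul {Ω : Type*} [Fintype Ω] [DecidableEq Ω]
    {ν : Ω → ℝ} {μ : (Ω → Ω) → ℝ} (hμ1 : ∑ m : Ω → Ω, μ m = 1)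
    {N : Submonoid (Function.End Ω)} (hN : ∀ m : Function.End Ω, μ m ≠ 0 → m ∈ N)
    {g : Ω → ℝ} (hg : g ∈ invariantFunctions ν N) (n : Function.End Ω) (hn : n ∈ N) :
    ∑ ω : Ω, markovOp μ g (n ω) * ν ω = ∑ ω : Ω, g ω * ν ω := by
  have hterm : ∀ m : Ω → Ω,
      ∑ ω : Ω, μ m * g (m (n ω)) * ν ω = μ m * ∑ ω : Ω, g ω * ν ω := by
    intro m
    by_cases h : μ m = 0
    · simp [h]
    · have key : ∑ ω : Ω, g (m (n ω)) * ν ω = ∑ ω : Ω, g ω * ν ω :=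
        hg _ (N.mul_mem (hN m h) hn)
      simp only [mul_assoc, ← Finset.mul_sum, key]
  calc ∑ ω : Ω, markovOp μ g (n ω) * ν ω
      = ∑ ω : Ω, ∑ m : Ω → Ω, μ m * g (m (n ω)) * ν ω :=
        Finset.sum_congr rfl fun ω _ => Finset.sum_mul _ _ _
    _ = ∑ m : Ω → Ω, μ m * ∑ ω : Ω, g ω * ν ω := by
        rw [Finset.sum_comm]; exact Finset.sum_congr rfl fun m _ => hterm m
    _ = ∑ ω : Ω, g ω * ν ω := by rw [← Finset.sum_mul, hμ1, one_mul]

theorem markovOp_mem_invariantFunctions {Ω : Type*} [Fintype Ω] [DecidableEq Ω]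
    {ν : Ω → ℝ} {μ : (Ω → Ω) → ℝ} (hμ1 : ∑ m : Ω → Ω, μ m = 1)
    {N : Submonoid (Function.End Ω)} (hN : ∀ m : Function.End Ω, μ m ≠ 0 → m ∈ N)
    {g : Ω → ℝ} (hg : g ∈ invariantFunctions ν N) :
    markovOp μ g ∈ invariantFunctions ν N := fun n hn =>
  (sum_markovOp_comp_mul hμ1 hN hg n hn).trans
    (sum_markovOp_comp_mul hμ1 hN hg 1 N.one_mem).symm

theorem sum_markovOp_mul_of_stationary {Ω : Type*} [Fintype Ω] [DecidableEq Ω]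
    {μ : (Ω → Ω) → ℝ} {π : Ω → ℝ}
    (hstat : ∀ β : Ω,
      ∑ α : Ω, π α * (∑ m : Ω → Ω, if m α = β then μ m else 0) = π β) (g : Ω → ℝ) :
    ∑ ω : Ω, markovOp μ g ω * π ω = ∑ ω : Ω, g ω * π ω := by
  have hop : ∀ α : Ω, markovOp μ g α =
      ∑ β : Ω, g β * ∑ m : Ω → Ω, if m α = β then μ m else 0 := by
    intro α
    simp only [Finset.mul_sum]
    rw [Finset.sum_comm]
    refine Finset.sum_congr rfl fun m _ => ?_
    simp [mul_comm]
  calc ∑ ω : Ω, markovOp μ g ω * π ω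
      = ∑ α : Ω, ∑ β : Ω,
          g β * (π α * ∑ m : Ω → Ω, if m α = β then μ m else 0) := by
        refine Finset.sum_congr rfl fun α _ => ?_
        rw [hop, Finset.sum_mul]
        exact Finset.sum_congr rfl fun β _ => by ring
    _ = ∑ β : Ω, g β * π β := by
        rw [Finset.sum_comm]
        exact Finset.sum_congr rfl fun β _ => by rw [← Finset.mul_sum, hstat]

/-- The maximum principle: harmonic functions of a transitive chain are constant. -/
theorem eq_of_markovOp_eq_self {Ω : Type*} [Fintype Ω] [DecidableEq Ω]
    {μ : (Ω → Ω) → ℝ} (hμ0 : ∀ m : Ω → Ω, 0 ≤ μ m) (hμ1 : ∑ m : Ω → Ω, μ m = 1)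
    (htrans : ∀ α β : Ω,
      ∃ m ∈ Submonoid.closure {m : Function.End Ω | μ m ≠ 0}, m α = β)
    {g : Ω → ℝ} (hg : markovOp μ g = g) (α β : Ω) : g α = g β := by
  have : Nonempty Ω := ⟨α⟩
  obtain ⟨ω₀, hω₀⟩ := Finite.exists_max g
  have step : ∀ m : Ω → Ω, μ m ≠ 0 → ∀ ω, g ω = g ω₀ → g (m ω) = g ω₀ := by
    intro m hm ω hω
    have hsum : ∑ m : Ω → Ω, μ m * (g ω₀ - g (m ω)) = 0 := by
      have h : ∑ m : Ω → Ω, μ m * g (m ω) = g ω := congrFun hg ω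
      simp only [mul_sub, Finset.sum_sub_distrib, ← Finset.sum_mul, hμ1, h, hω, one_mul, sub_self]
    have hzero := (Finset.sum_eq_zero_iff_of_nonneg fun m _ =>
      mul_nonneg (hμ0 m) (sub_nonneg.2 (hω₀ (m ω)))).1 hsum m (Finset.mem_univ m)
    rcases mul_eq_zero.1 hzero with h | h
    · exact absurd h hm
    · linarith
  have hmax : ∀ m ∈ Submonoid.closure {m : Function.End Ω | μ m ≠ 0},
      ∀ ω, g ω = g ω₀ → g (m ω) = g ω₀ := by
    intro m hm
    induction hm using Submonoid.closure_induction with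
    | mem m hm => exact step m hm
    | one => exact fun ω hω => hω
    | mul m n _ _ ihm ihn => exact fun ω hω => ihm _ (ihn ω hω)
  have hconst : ∀ ω, g ω = g ω₀ := by
    intro ω
    obtain ⟨m, hm, rfl⟩ := htrans ω₀ ω
    exact hmax m hm ω₀ rfl
  rw [hconst α, hconst β]


/-- Ergodic theorem. Let `(Ω, M)` be a finite transformation monoid,
`ν` a probability distribution on `Ω`, `μ` a probability distribution on `M` such that
the submonoid `N` generated by the support of `μ` is transitive on `Ω`.  Let
`P(α, β) = ∑_{m : αm = β} μ m` and let `π` be a stationary distribution for `P`.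
If `f : Ω → ℝ` satisfies `E_ν(mf) = E_ν(f)` for all `m ∈ N`, then
`E_π(f) = E_ν(f)`. -/
theorem ergodic_theorem {Ω : Type*} [Fintype Ω] [DecidableEq Ω]
    (S : Set (Ω → Ω)) (hid : id ∈ S) (hcomp : ∀ m ∈ S, ∀ n ∈ S, n ∘ m ∈ S)
    (ν : Ω → ℝ) (hν0 : ∀ ω : Ω, 0 ≤ ν ω) (hν1 : ∑ ω : Ω, ν ω = 1)
    (μ : (Ω → Ω) → ℝ) (hμ0 : ∀ m : Ω → Ω, 0 ≤ μ m) (hμ1 : ∑ m : Ω → Ω, μ m = 1)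
    (hsupp : ∀ m : Ω → Ω, μ m ≠ 0 → m ∈ S)
    (htrans : ∀ α β : Ω,
      ∃ m ∈ Submonoid.closure {m : Function.End Ω | μ m ≠ 0}, m α = β)
    (π : Ω → ℝ) (hπ0 : ∀ ω : Ω, 0 ≤ π ω) (hπ1 : ∑ ω : Ω, π ω = 1)
    (hstat : ∀ β : Ω,
      ∑ α : Ω, π α * (∑ m : Ω → Ω, if m α = β then μ m else 0) = π β)
    (f : Ω → ℝ)
    (hf : ∀ m ∈ Submonoid.closure {m : Function.End Ω | μ m ≠ 0},
      ∑ ω : Ω, f (m ω) * ν ω = ∑ ω : Ω, f ω * ν ω) :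
    ∑ ω : Ω, f ω * π ω = ∑ ω : Ω, f ω * ν ω := by
  set N := Submonoid.closure {m : Function.End Ω | μ m ≠ 0}
  have hN : ∀ m : Function.End Ω, μ m ≠ 0 → m ∈ N := fun m hm => Submonoid.subset_closure hm
  let W := invariantFunctions ν N
  have hone : (1 : Ω → ℝ) ∈ W := fun m _ => rfl
  let E : (Ω → ℝ) →ₗ[ℝ] ℝ := ∑ ω : Ω, π ω • LinearMap.proj ω
  have hE : ∀ g : Ω → ℝ, E g = ∑ ω : Ω, g ω * π ω := by
    intro g
    simp [E, LinearMap.sum_apply, mul_comm]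
  let T : (Ω → ℝ) →ₗ[ℝ] (Ω → ℝ) := markovOp μ - LinearMap.id + E.smulRight 1
  have hT : ∀ g ω, T g ω = markovOp μ g ω - g ω + E g := by
    intro g ω
    simp [T]
  have hTW : ∀ g ∈ W, T g ∈ W := fun g hg =>
    W.add_mem (W.sub_mem (markovOp_mem_invariantFunctions hμ1 hN hg) hg) (W.smul_mem _ hone)
  have hET : ∀ g, ∑ ω : Ω, T g ω * π ω = E g := by
    intro g
    simp only [hT, add_mul, sub_mul, Finset.sum_add_distrib, Finset.sum_sub_distrib,
      ← Finset.mul_sum, hπ1, sum_markovOp_mul_of_stationary hstat g]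
    ring
  have hinj : Function.Injective (T.restrict hTW) := by
    rw [← LinearMap.ker_eq_bot, LinearMap.ker_eq_bot']
    rintro ⟨g, hg⟩ h
    have hTg : T g = 0 := congrArg Subtype.val h
    have hEg : E g = 0 := by rw [← hET, hTg]; simp
    have hharm : markovOp μ g = g := by
      ext ω
      have := hT g ω
      rw [hTg, hEg] at this
      simp only [Pi.zero_apply] at this
      linarith
    have hconst := eq_of_markovOp_eq_self hμ0 hμ1 htrans hharm
    ext ω
    have : E g = g ω := by
      rw [hE, Finset.sum_congr rfl fun ω' _ => by rw [hconst ω' ω], ← Finset.mul_sum, hπ1,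
        mul_one]
    exact this.symm.trans hEg
  obtain ⟨⟨h, hh⟩, hTh⟩ := LinearMap.injective_iff_surjective.1 hinj ⟨f, hf⟩
  have hfh : T h = f := congrArg Subtype.val hTh
  have hPh : ∑ ω : Ω, markovOp μ h ω * ν ω = ∑ ω : Ω, h ω * ν ω :=
    sum_markovOp_comp_mul hμ1 hN hh 1 N.one_mem
  rw [← hfh, hET]
  simp only [hT, add_mul, sub_mul, Finset.sum_add_distrib, Finset.sum_sub_distrib,
    ← Finset.mul_sum, hν1, hPh]
  ring
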